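/- arXiv:1702.02767 — 2 statements merged into one kernel-verified Lean document; each statement's English description precedes it below -/
import Mathlib

section
/- For every c > 0, sup_{y ∈ [0, c]} | (P_n'(cos(y/n)) · sin(y/n))² / P_n'(1) − 2 (J₀'(y))² | → 0 as n → ∞. -/
open Real

/-- The degree-`n` Legendre polynomial, via the Rodrigues formula. -/
noncomputable def legendre (n : ℕ) (x : ℝ) : ℝ :=
  (1 / (2 ^ n * (n.factorial : ℝ))) * iteratedDeriv n (fun t : ℝ => (t ^ 2 - 1) ^ n) x

/-- The Bessel function of the first kind of order `0`. -/
noncomputable def besselJ0 (y : ℝ) : ℝ :=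
  ∑' j : ℕ, (-1) ^ j / ((j.factorial : ℝ)) ^ 2 * (y / 2) ^ (2 * j)

open Filter Topology

/-- The `n`-th derivative of a polynomial composed with an affine map. -/
lemma iteratedDeriv_eval_affine (p : Polynomial ℝ) (a b : ℝ) (n : ℕ) :
    iteratedDeriv n (fun t => p.eval (a * t + b)) =
      fun t => a ^ n * (Polynomial.derivative^[n] p).eval (a * t + b) := by
  induction n with
  | zero => simp
  | succ n ih =>
    rw [iteratedDeriv_succ, ih]
    funext t
    have h : HasDerivAt (fun t : ℝ => a * t + b) a t := by
      simpa using ((hasDerivAt_id t).const_mul a).add_const b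
    have h' := (((Polynomial.derivative^[n] p).hasDerivAt (a * t + b)).comp t h).const_mul (a ^ n)
    simp only [Function.comp_def] at h'
    rw [h'.deriv, Function.iterate_succ_apply']
    ring

lemma legendre_eq_aeval_shiftedLegendre (n : ℕ) (x : ℝ) :
    legendre n x = Polynomial.aeval ((1 - x) / 2) (Polynomial.shiftedLegendre n) := by
  have hf : (fun t : ℝ => (t ^ 2 - 1) ^ n) = fun t => (-4) ^ n *
      (((Polynomial.X ^ n * (1 - Polynomial.X) ^ n : Polynomial ℤ)).map
        (Int.castRingHom ℝ)).eval (-1 / 2 * t + 1 / 2) := by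
    funext t
    simp only [Polynomial.map_mul, Polynomial.map_pow, Polynomial.map_sub, Polynomial.map_X,
      Polynomial.map_one, Polynomial.eval_mul, Polynomial.eval_pow, Polynomial.eval_sub,
      Polynomial.eval_X, Polynomial.eval_one]
    rw [← mul_pow, ← mul_pow]
    ring
  rw [legendre, hf, iteratedDeriv_const_mul_field, iteratedDeriv_eval_affine]
  rw [Polynomial.iterate_derivative_map, ← Polynomial.factorial_mul_shiftedLegendre_eq]
  have hx : -1 / 2 * x + 1 / 2 = (1 - x) / 2 := by ring
  have h2 : ((-4 : ℝ)) ^ n * (-1 / 2) ^ n = 2 ^ n := by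
    rw [← mul_pow]; norm_num
  have hfac : (n.factorial : ℝ) ≠ 0 := by positivity
  simp only [Polynomial.map_mul, Polynomial.map_natCast, Polynomial.eval_mul,
    Polynomial.eval_natCast, hx, Polynomial.aeval_def, Polynomial.eval_map]
  rw [← mul_assoc ((-4 : ℝ) ^ n), h2]
  field_simp
  rfl

lemma legendre_eq_sum (n : ℕ) (x : ℝ) :
    legendre n x = ∑ k ∈ Finset.range (n + 1),
      (-1) ^ k * (n.choose k : ℝ) * ((n + k).choose n : ℝ) * ((1 - x) / 2) ^ k := by
  rw [legendre_eq_aeval_shiftedLegendre, Polynomial.shiftedLegendre, map_sum]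
  refine Finset.sum_congr rfl fun k _ => ?_
  simp

lemma deriv_legendre (n : ℕ) (x : ℝ) :
    deriv (legendre n) x = -1 / 2 * ∑ j ∈ Finset.range n,
      (-1) ^ (j + 1) * (n.choose (j + 1) : ℝ) * ((n + (j + 1)).choose n : ℝ) * (j + 1) *
        ((1 - x) / 2) ^ j := by
  rw [funext (legendre_eq_sum n)]
  have h : HasDerivAt (fun t : ℝ => (1 - t) / 2) (-1 / 2) x := by
    simpa using ((hasDerivAt_id x).const_sub 1).div_const 2
  have := HasDerivAt.fun_sum (u := Finset.range (n + 1)) fun k _ =>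
    (h.fun_pow k).const_mul ((-1) ^ k * (n.choose k : ℝ) * ((n + k).choose n : ℝ))
  rw [this.deriv, Finset.sum_range_succ', Finset.mul_sum]
  simp only [Nat.cast_zero, zero_mul, mul_zero, add_zero]
  refine Finset.sum_congr rfl fun j _ => ?_
  simp only [Nat.add_sub_cancel]
  push_cast
  ring

lemma deriv_legendre_one (n : ℕ) : deriv (legendre n) 1 = n * (n + 1) / 2 := by
  rw [deriv_legendre]
  cases n with
  | zero => simp
  | succ m =>
    rw [Finset.sum_range_succ']
    have : (m + 1 + (0 + 1)).choose (m + 1) = m + 2 := by simp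
    rw [this]
    simp
    ring

lemma tendsto_descFactorial_div_pow (k : ℕ) :
    Tendsto (fun n : ℕ => (n.descFactorial k : ℝ) / n ^ k) atTop (𝓝 1) :=
  (Asymptotics.isEquivalent_iff_tendsto_one (by
    filter_upwards [eventually_gt_atTop 0] with n hn
    have : (0 : ℝ) < n := by exact_mod_cast hn
    positivity)).1 (isEquivalent_descFactorial k)

lemma tendsto_add_descFactorial_div_pow (k : ℕ) :
    Tendsto (fun n : ℕ => ((n + k).descFactorial k : ℝ) / n ^ k) atTop (𝓝 1) := by
  have h1 := (tendsto_descFactorial_div_pow k).comp (tendsto_add_atTop_nat k)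
  have h2 : Tendsto (fun n : ℕ => (1 + (k : ℝ) / n) ^ k) atTop (𝓝 1) := by
    simpa using ((tendsto_const_div_atTop_nhds_zero_nat (k : ℝ)).const_add 1).pow k
  have h := h1.mul h2
  rw [one_mul] at h
  refine h.congr' ?_
  filter_upwards [eventually_gt_atTop 0] with n hn
  have hn' : (0 : ℝ) < n := by exact_mod_cast hn
  have hk : (0 : ℝ) < n + k := by positivity
  simp only [Function.comp, Nat.cast_add]
  rw [show 1 + (k : ℝ) / n = (n + k) / n by field_simp, div_pow]
  field_simp

/-- The `j`-th term of the power series of `J₀'`. -/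
noncomputable def besselDerivTerm (y : ℝ) (j : ℕ) : ℝ :=
  (-1) ^ (j + 1) / ((j.factorial : ℝ) * (j + 1).factorial) * (y / 2) ^ (2 * j) * (y / 2)

lemma norm_besselDerivTerm_le {R y : ℝ} (hy : |y| ≤ R) (j : ℕ) :
    ‖besselDerivTerm y j‖ ≤ (R ^ 2) ^ j / (j.factorial : ℝ) * R := by
  have hR : 0 ≤ R := (abs_nonneg y).trans hy
  have h2 : |y / 2| ≤ R := by
    rw [abs_div, abs_two]; linarith [abs_nonneg y]
  have h1 : (1 : ℝ) ≤ (j + 1).factorial := by exact_mod_cast Nat.succ_le_of_lt (Nat.factorial_pos _)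
  have h0 : (0 : ℝ) < j.factorial := by positivity
  rw [besselDerivTerm, Real.norm_eq_abs, abs_mul, abs_mul, abs_div, abs_pow, abs_neg, abs_one,
    one_pow, abs_of_pos (by positivity : (0 : ℝ) < j.factorial * (j + 1).factorial), abs_pow,
    ← pow_mul, div_mul_eq_mul_div, one_mul]
  gcongr
  nlinarith

lemma besselJ0_eq (y : ℝ) : besselJ0 y =
    1 + ∑' j : ℕ, (-1) ^ (j + 1) / (((j + 1).factorial : ℝ)) ^ 2 * (y / 2) ^ (2 * (j + 1)) := by
  have hs : Summable fun j : ℕ =>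
      (-1) ^ j / ((j.factorial : ℝ)) ^ 2 * (y / 2) ^ (2 * j) := by
    refine .of_norm_bounded (Real.summable_pow_div_factorial ((y / 2) ^ 2)) fun j => ?_
    have h1 : (1 : ℝ) ≤ j.factorial := by exact_mod_cast Nat.succ_le_of_lt (Nat.factorial_pos _)
    rw [Real.norm_eq_abs, abs_mul, abs_div, abs_pow, abs_neg, abs_one, one_pow, pow_mul,
      abs_of_nonneg (by positivity : (0 : ℝ) ≤ ((y / 2) ^ 2) ^ j),
      abs_of_nonneg (by positivity : (0 : ℝ) ≤ (j.factorial : ℝ) ^ 2), div_mul_eq_mul_div, one_mul]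
    gcongr
    nlinarith
  rw [besselJ0, hs.tsum_eq_zero_add]
  simp

lemma hasDerivAt_besselJ0 (y : ℝ) : HasDerivAt besselJ0 (∑' j, besselDerivTerm y j) y := by
  have hy : y ∈ Metric.ball (0 : ℝ) (|y| + 1) := by simp
  rw [funext besselJ0_eq]
  refine HasDerivAt.const_add 1 ?_
  refine hasDerivAt_tsum_of_isPreconnected
    (u := fun j : ℕ => ((|y| + 1) ^ 2) ^ j / (j.factorial : ℝ) * (|y| + 1))
    (g' := fun j z => besselDerivTerm z j) (y₀ := 0)
    ((Real.summable_pow_div_factorial _).mul_right _) Metric.isOpen_ball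
    (convex_ball _ _).isPreconnected (fun j z _ => ?_) (fun j z hz => ?_) (by simp; positivity)
    (by simp) hy
  · have h := (((hasDerivAt_id z).div_const 2).fun_pow (2 * (j + 1))).const_mul
      ((-1) ^ (j + 1) / (((j + 1).factorial : ℝ)) ^ 2)
    refine h.congr_deriv ?_
    rw [besselDerivTerm, show 2 * (j + 1) - 1 = 2 * j + 1 by omega, Nat.factorial_succ]
    push_cast
    field_simp
    simp
    ring
  · exact norm_besselDerivTerm_le (by simpa using (Metric.mem_ball.1 hz).le) j

lemma continuous_deriv_besselJ0 : Continuous (deriv besselJ0) := by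
  rw [funext fun y => (hasDerivAt_besselJ0 y).deriv, continuous_iff_continuousAt]
  intro y
  have hy : Metric.ball (0 : ℝ) (|y| + 1) ∈ 𝓝 y := Metric.isOpen_ball.mem_nhds (by simp)
  refine ContinuousOn.continuousAt (continuousOn_tsum (fun j => ?_)
    ((Real.summable_pow_div_factorial ((|y| + 1) ^ 2)).mul_right (|y| + 1)) fun j z hz =>
      norm_besselDerivTerm_le (by simpa using (Metric.mem_ball.1 hz).le) j) hy
  unfold besselDerivTerm
  fun_prop

/-- The `j`-th term of the expansion of `-P_n'(cos (y/n)) sin (y/n) / n`. -/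
noncomputable def legendreDerivTerm (n : ℕ) (y : ℝ) (j : ℕ) : ℝ :=
  (-1) ^ (j + 1) / ((j.factorial : ℝ) * (j + 1).factorial) *
    ((n.descFactorial (j + 1) : ℝ) / n ^ (j + 1) *
      (((n + (j + 1)).descFactorial (j + 1) : ℝ) / n ^ (j + 1))) *
    (y / 2 * sinc (y / (2 * n))) ^ (2 * j) * (y / 2 * sinc (y / n))

lemma mul_sinc_div {n : ℕ} (hn : 0 < n) (y : ℝ) : y * sinc (y / n) = n * sin (y / n) := by
  have hn' : (n : ℝ) ≠ 0 := by positivity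
  rcases eq_or_ne y 0 with rfl | hy
  · simp
  · rw [sinc_of_ne_zero (div_ne_zero hy hn')]
    field_simp

lemma deriv_legendre_cos_mul_sin {n : ℕ} (hn : 0 < n) (y : ℝ) :
    deriv (legendre n) (cos (y / n)) * sin (y / n) = -n * ∑' j, legendreDerivTerm n y j := by
  have hn' : (n : ℝ) ≠ 0 := by positivity
  rw [tsum_eq_sum (s := Finset.range n) (fun j hj => by
    have : n < j + 1 := by simpa [Nat.lt_succ_iff] using hj
    simp only [legendreDerivTerm, Nat.descFactorial_eq_zero_iff_lt.2 this]
    simp),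
    deriv_legendre, Finset.mul_sum, Finset.mul_sum, Finset.sum_mul]
  refine Finset.sum_congr rfl fun j _ => ?_
  have h1 : (1 - cos (y / n)) / 2 = sin (y / (2 * n)) ^ 2 := by
    rw [sin_sq_eq_half_sub, show 2 * (y / (2 * n)) = y / n by field_simp]
    ring
  have h2 : y / 2 * sinc (y / n) = n * sin (y / n) / 2 := by
    rw [← mul_sinc_div hn]; ring
  have h3 : y / 2 * sinc (y / (2 * n)) = n * sin (y / (2 * n)) := by
    have := mul_sinc_div hn (y / 2)
    rwa [div_div] at this
  have h4 : (n + (j + 1)).choose n = (n + (j + 1)).choose (j + 1) :=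
    Nat.choose_symm_add
  rw [legendreDerivTerm, h1, h2, h3, h4, Nat.descFactorial_eq_factorial_mul_choose,
    Nat.descFactorial_eq_factorial_mul_choose, mul_pow, Nat.factorial_succ]
  push_cast
  have : (j.factorial : ℝ) ≠ 0 := by positivity
  field_simp
  ring

lemma norm_legendreDerivTerm_le {R y : ℝ} (hy : |y| ≤ R) {n : ℕ} (hn : 0 < n) (j : ℕ) :
    ‖legendreDerivTerm n y j‖ ≤ (2 * R ^ 2) ^ j / (j.factorial : ℝ) * (2 * R) := by
  have hn' : (0 : ℝ) < n := by positivity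
  have hR : 0 ≤ R := (abs_nonneg y).trans hy
  rcases lt_or_ge n (j + 1) with h | h
  · simp only [legendreDerivTerm, Nat.descFactorial_eq_zero_iff_lt.2 h]
    simp
    positivity
  have hs (x : ℝ) : |y / 2 * sinc x| ≤ R := by
    rw [abs_mul, abs_div, abs_two]
    nlinarith [abs_sinc_le_one x, abs_nonneg y, abs_nonneg (sinc x)]
  have ha : (n.descFactorial (j + 1) : ℝ) / n ^ (j + 1) ≤ 1 := by
    rw [div_le_one (by positivity)]
    exact_mod_cast Nat.descFactorial_le_pow n (j + 1)
  have hb : ((n + (j + 1)).descFactorial (j + 1) : ℝ) / n ^ (j + 1) ≤ 2 ^ (j + 1) := by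
    rw [div_le_iff₀ (by positivity), ← mul_pow]
    have : (n + (j + 1)).descFactorial (j + 1) ≤ (2 * n) ^ (j + 1) :=
      (Nat.descFactorial_le_pow _ _).trans (Nat.pow_le_pow_left (by omega) _)
    exact_mod_cast this
  have h1 : (1 : ℝ) ≤ (j + 1).factorial := by exact_mod_cast Nat.succ_le_of_lt (Nat.factorial_pos _)
  have h0 : (0 : ℝ) < j.factorial := by positivity
  have hc : |(-1 : ℝ) ^ (j + 1) / ((j.factorial : ℝ) * (j + 1).factorial)| ≤
      1 / j.factorial := by
    rw [abs_div, abs_pow, abs_neg, abs_one, one_pow, abs_of_pos (by positivity)]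
    gcongr
    nlinarith
  rw [legendreDerivTerm, Real.norm_eq_abs, abs_mul, abs_mul, abs_mul, abs_pow,
    abs_of_nonneg (by positivity : 0 ≤ (n.descFactorial (j + 1) : ℝ) / n ^ (j + 1) *
      (((n + (j + 1)).descFactorial (j + 1) : ℝ) / n ^ (j + 1)))]
  calc _ ≤ 1 / (j.factorial : ℝ) * (1 * 2 ^ (j + 1)) * R ^ (2 * j) * R := by
        gcongr
        · exact hs _
        · exact hs _
    _ = _ := by rw [mul_pow, ← pow_mul]; ring

lemma tendsto_legendreDerivTerm (y : ℝ) (j : ℕ) :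
    Tendsto (fun p : ℕ × ℝ => legendreDerivTerm p.1 p.2 j) (atTop ×ˢ 𝓝 y)
      (𝓝 (besselDerivTerm y j)) := by
  have hn : Tendsto (fun p : ℕ × ℝ => p.1) (atTop ×ˢ 𝓝 y) atTop := tendsto_fst
  have hy : Tendsto (fun p : ℕ × ℝ => p.2) (atTop ×ˢ 𝓝 y) (𝓝 y) := tendsto_snd
  have hr : Tendsto (fun p : ℕ × ℝ => (p.1 : ℝ)) (atTop ×ˢ 𝓝 y) atTop :=
    tendsto_natCast_atTop_atTop.comp hn
  have hs : Tendsto (fun p : ℕ × ℝ => sinc (p.2 / p.1)) (atTop ×ˢ 𝓝 y) (𝓝 1) :=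
    sinc_zero ▸ (continuous_sinc.tendsto 0).comp (hy.div_atTop hr)
  have hs' : Tendsto (fun p : ℕ × ℝ => sinc (p.2 / (2 * p.1))) (atTop ×ˢ 𝓝 y) (𝓝 1) :=
    sinc_zero ▸ (continuous_sinc.tendsto 0).comp
      (hy.div_atTop (hr.const_mul_atTop two_pos))
  have h := ((((tendsto_descFactorial_div_pow (j + 1)).comp hn).mul
    ((tendsto_add_descFactorial_div_pow (j + 1)).comp hn)).const_mul
      ((-1 : ℝ) ^ (j + 1) / ((j.factorial : ℝ) * (j + 1).factorial))).mul
    (((hy.div_const 2).mul hs').pow (2 * j)) |>.mul ((hy.div_const 2).mul hs)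
  simp only [mul_one] at h
  exact h

lemma tendsto_tsum_legendreDerivTerm (y : ℝ) :
    Tendsto (fun p : ℕ × ℝ => ∑' j, legendreDerivTerm p.1 p.2 j) (atTop ×ˢ 𝓝 y)
      (𝓝 (deriv besselJ0 y)) := by
  rw [(hasDerivAt_besselJ0 y).deriv]
  refine tendsto_tsum_of_dominated_convergence
    ((Real.summable_pow_div_factorial (2 * (|y| + 1) ^ 2)).mul_right (2 * (|y| + 1)))
    (tendsto_legendreDerivTerm y) ?_
  have hy : ∀ᶠ z in 𝓝 y, |z| < |y| + 1 :=
    continuous_abs.continuousAt.eventually_lt continuousAt_const (lt_add_one _)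
  filter_upwards [(eventually_gt_atTop 0).prod_mk hy] with p hp j
  exact norm_legendreDerivTerm_le hp.2.le hp.1 j

lemma tendsto_legendre_deriv_sub_bessel (y : ℝ) :
    Tendsto (fun p : ℕ × ℝ =>
      (deriv (legendre p.1) (cos (p.2 / p.1)) * sin (p.2 / p.1)) ^ 2 / deriv (legendre p.1) 1 -
        2 * (deriv besselJ0 p.2) ^ 2) (atTop ×ˢ 𝓝 y) (𝓝 0) := by
  have hn : Tendsto (fun p : ℕ × ℝ => p.1) (atTop ×ˢ 𝓝 y) atTop := tendsto_fst
  have hb : Tendsto (fun p : ℕ × ℝ => deriv besselJ0 p.2) (atTop ×ˢ 𝓝 y)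
      (𝓝 (deriv besselJ0 y)) := (continuous_deriv_besselJ0.tendsto y).comp tendsto_snd
  have h := ((((tendsto_tsum_legendreDerivTerm y).pow 2).const_mul 2).mul
    ((tendsto_natCast_div_add_atTop (1 : ℝ)).comp hn)).sub ((hb.pow 2).const_mul 2)
  rw [mul_one, sub_self] at h
  refine h.congr' ?_
  filter_upwards [hn.eventually (eventually_gt_atTop 0)] with p hp
  have hp' : (p.1 : ℝ) ≠ 0 := by positivity
  have hp1 : (p.1 : ℝ) + 1 ≠ 0 := by positivity
  rw [deriv_legendre_cos_mul_sin hp, deriv_legendre_one]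
  simp only [Function.comp]
  field_simp

/-- For every `c > 0`,
`sup_{y ∈ [0,c]} |(P_n'(cos(y/n)) sin(y/n))²/P_n'(1) − 2 J₀'(y)²| → 0` as `n → ∞`. -/
theorem legendre_deriv_rescaled_bessel (c : ℝ) (hc : 0 < c) :
    ∀ ε : ℝ, 0 < ε → ∃ N : ℕ, ∀ n : ℕ, N ≤ n → ∀ y ∈ Set.Icc (0 : ℝ) c,
      |(deriv (legendre n) (cos (y / n)) * sin (y / n)) ^ 2 / deriv (legendre n) 1 -
        2 * (deriv besselJ0 y) ^ 2| < ε := by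
  intro ε hε
  have h := isCompact_Icc.mem_prod_nhdsSet_of_forall (K := Set.Icc 0 c) (l := atTop)
    fun y _ => (tendsto_legendre_deriv_sub_bessel y).eventually
      (Metric.ball_mem_nhds (0 : ℝ) hε)
  obtain ⟨A, hA, B, hB, hAB⟩ := mem_prod_iff.1 h
  obtain ⟨N, hN⟩ := mem_atTop_sets.1 hA
  refine ⟨N, fun n hn y hy => ?_⟩
  have := hAB (Set.mk_mem_prod (hN n hn) (subset_of_mem_nhdsSet hB hy))
  simpa using this
end

section
/- As n → ∞, sup over θ ∈ [n^{−3/4}, π/2] of | (1 − P_n(cos θ)) / √(2 − 2 P_n(cos θ) − (P_n'(cos θ) sin θ)² / P_n'(1)) − 1/√2 | tends to 0. In particular, the infimum over θ ∈ [n^{−3/4}, π/2] of (1 − P_n(cos θ)) / √(2 − 2 P_n(cos θ) − (P_n'(cos θ) sin θ)² / P_n'(1)) converges to 1/√2 as n → ∞. -/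
open Real Filter

/-- The ratio appearing in the critical-radius computation for `S²`. -/
noncomputable def legendreRatio (n : ℕ) (θ : ℝ) : ℝ :=
  (1 - legendre n (cos θ)) /
    Real.sqrt (2 - 2 * legendre n (cos θ) -
      (deriv (legendre n) (cos θ) * sin θ) ^ 2 / deriv (legendre n) 1)

open Polynomial in
theorem ode_iterate_derivative (n k : ℕ) :
    (X ^ 2 - 1) * derivative^[k + 2] ((X ^ 2 - 1 : ℝ[X]) ^ n)
      + 2 * ((k : ℝ[X]) + 1) * X * derivative^[k + 1] ((X ^ 2 - 1 : ℝ[X]) ^ n)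
      + (k : ℝ[X]) * ((k : ℝ[X]) + 1) * derivative^[k] ((X ^ 2 - 1 : ℝ[X]) ^ n)
    = 2 * (n : ℝ[X]) * X * derivative^[k + 1] ((X ^ 2 - 1 : ℝ[X]) ^ n)
      + 2 * (n : ℝ[X]) * ((k : ℝ[X]) + 1) * derivative^[k] ((X ^ 2 - 1 : ℝ[X]) ^ n) := by
  have hX : derivative (X ^ 2 - 1 : ℝ[X]) = 2 * X := by
    rw [derivative_sub, derivative_X_sq, derivative_one, sub_zero, C_ofNat]
  induction k with
  | zero =>
    have h : (X ^ 2 - 1) * derivative ((X ^ 2 - 1 : ℝ[X]) ^ n)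
        = 2 * (n : ℝ[X]) * X * (X ^ 2 - 1 : ℝ[X]) ^ n := by
      cases n with
      | zero => simp
      | succ m =>
        rw [derivative_pow, hX, C_eq_natCast, Nat.add_sub_cancel]
        ring
    have h' := congrArg derivative h
    simp only [derivative_mul, hX, derivative_X, derivative_natCast, derivative_ofNat] at h'
    simp only [Function.iterate_succ_apply', Function.iterate_zero, id_eq, Nat.cast_zero]
    linear_combination h'
  | succ k ih =>
    have h' := congrArg derivative ih
    simp only [derivative_mul, derivative_add, hX, derivative_one,
      derivative_X, derivative_natCast, derivative_ofNat,
      ← Function.iterate_succ_apply' derivative] at h'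
    push_cast
    linear_combination h'

open Polynomial in
/-- The Legendre polynomial as an element of `ℝ[X]`. -/
noncomputable def legendrePoly (n : ℕ) : ℝ[X] :=
  C (1 / (2 ^ n * (n.factorial : ℝ))) * derivative^[n] ((X ^ 2 - 1) ^ n)

open Polynomial in
theorem iteratedDeriv_polynomial_eval (p : ℝ[X]) (k : ℕ) :
    iteratedDeriv k (fun t => p.eval t) = fun t => (derivative^[k] p).eval t := by
  induction k with
  | zero => simp
  | succ k ih =>
    rw [iteratedDeriv_succ, ih]
    funext t
    rw [Polynomial.deriv, Function.iterate_succ_apply']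

theorem legendre_eq_eval (n : ℕ) : legendre n = fun x => (legendrePoly n).eval x := by
  funext x
  have h := congrFun (iteratedDeriv_polynomial_eval ((Polynomial.X ^ 2 - 1) ^ n) n) x
  simp only [Polynomial.eval_pow, Polynomial.eval_sub, Polynomial.eval_X,
    Polynomial.eval_one] at h
  simp [legendre, legendrePoly, h]

theorem deriv_legendre_s13 (n : ℕ) :
    deriv (legendre n) = fun x => (legendrePoly n).derivative.eval x := by
  funext x
  rw [legendre_eq_eval, Polynomial.deriv]

theorem legendrePoly_ode (n : ℕ) (x : ℝ) :
    (1 - x ^ 2) * (legendrePoly n).derivative.derivative.eval x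
      = 2 * x * (legendrePoly n).derivative.eval x
        - (n * (n + 1) : ℝ) * (legendrePoly n).eval x := by
  have h := congrArg (Polynomial.eval x) (ode_iterate_derivative n n)
  simp only [Function.iterate_succ_apply', Polynomial.eval_add, Polynomial.eval_mul,
    Polynomial.eval_sub, Polynomial.eval_pow, Polynomial.eval_X, Polynomial.eval_one,
    Polynomial.eval_natCast, Polynomial.eval_ofNat] at h
  simp only [legendrePoly, Polynomial.derivative_C_mul, Polynomial.eval_mul, Polynomial.eval_C]
  linear_combination -(1 / (2 ^ n * (n.factorial : ℝ))) * h

theorem legendrePoly_eval_one (n : ℕ) : (legendrePoly n).eval 1 = 1 := by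
  have h := Polynomial.aeval_iterate_derivative_self ((Polynomial.X ^ 2 - 1 : Polynomial ℝ) ^ n) n
    (r := (1 : ℝ)) (p' := (Polynomial.X + 1) ^ n) (by
      rw [Algebra.algebraMap_self, Polynomial.map_id, ← mul_pow, Polynomial.C_1]
      ring)
  have h2 : (1 : ℝ) + 1 = 2 := by norm_num
  simp only [Polynomial.coe_aeval_eq_eval, Polynomial.eval_pow, Polynomial.eval_add,
    Polynomial.eval_X, Polynomial.eval_one, nsmul_eq_mul, h2] at h
  simp only [legendrePoly, Polynomial.eval_mul, Polynomial.eval_C, h]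
  field_simp

theorem legendrePoly_derivative_eval_one (n : ℕ) :
    (legendrePoly n).derivative.eval 1 = (n * (n + 1) : ℝ) / 2 := by
  have h := legendrePoly_ode n 1
  rw [legendrePoly_eval_one] at h
  linarith

theorem hasDerivAt_eval_cos (p : Polynomial ℝ) (θ : ℝ) :
    HasDerivAt (fun t => p.eval (cos t)) (-(sin θ * p.derivative.eval (cos θ))) θ := by
  refine ((p.hasDerivAt (cos θ)).comp θ (hasDerivAt_cos θ)).congr_deriv ?_
  ring

theorem hasDerivAt_sin_mul_derivative_legendrePoly (n : ℕ) (θ : ℝ) :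
    HasDerivAt (fun t => sin t * (legendrePoly n).derivative.eval (cos t))
      ((n * (n + 1) : ℝ) * (legendrePoly n).eval (cos θ)
        - cos θ * (legendrePoly n).derivative.eval (cos θ)) θ := by
  refine ((hasDerivAt_sin θ).mul
    (hasDerivAt_eval_cos (legendrePoly n).derivative θ)).congr_deriv ?_
  have h := legendrePoly_ode n (cos θ)
  rw [← sin_sq] at h
  linear_combination -h

/-- The energy of the Legendre equation in the angular variable, up to the factor `n (n + 1)`. -/
noncomputable def legendreEnergy (n : ℕ) (θ : ℝ) : ℝ :=
  (sin θ * (legendrePoly n).derivative.eval (cos θ)) ^ 2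
    + (n * (n + 1) : ℝ) * (legendrePoly n).eval (cos θ) ^ 2

theorem hasDerivAt_legendreEnergy (n : ℕ) (θ : ℝ) :
    HasDerivAt (legendreEnergy n)
      (-(2 * sin θ * cos θ * (legendrePoly n).derivative.eval (cos θ) ^ 2)) θ := by
  refine (((hasDerivAt_sin_mul_derivative_legendrePoly n θ).pow 2).add
    (((hasDerivAt_eval_cos (legendrePoly n) θ).pow 2).const_mul
      (n * (n + 1) : ℝ))).congr_deriv ?_
  norm_num
  ring

theorem legendreEnergy_le (n : ℕ) {θ : ℝ} (hθ : θ ∈ Set.Icc 0 (π / 2)) :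
    legendreEnergy n θ ≤ n * (n + 1) := by
  have hanti : AntitoneOn (legendreEnergy n) (Set.Icc 0 (π / 2)) := by
    refine antitoneOn_of_hasDerivWithinAt_nonpos (convex_Icc _ _)
      (fun t _ => (hasDerivAt_legendreEnergy n t).continuousAt.continuousWithinAt)
      (fun t _ => (hasDerivAt_legendreEnergy n t).hasDerivWithinAt) fun t ht => ?_
    rw [interior_Icc] at ht
    have hs : 0 ≤ sin t := sin_nonneg_of_nonneg_of_le_pi ht.1.le (by linarith [ht.2, pi_pos])
    have hc : 0 ≤ cos t := cos_nonneg_of_mem_Icc ⟨by linarith [ht.1, pi_pos], ht.2.le⟩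
    have := mul_nonneg (mul_nonneg hs hc)
      (sq_nonneg ((legendrePoly n).derivative.eval (cos t)))
    linarith
  have h := hanti (Set.left_mem_Icc.2 (by positivity)) hθ hθ.1
  simpa [legendreEnergy, legendrePoly_eval_one] using h

/-- A corrected energy, equal to `u'² + ((n + 1/2)² + 1 / (4 sin² θ)) u²` where
`u θ = √(sin θ) P_n (cos θ)`. -/
noncomputable def legendreSoninEnergy (n : ℕ) (θ : ℝ) : ℝ :=
  sin θ * legendreEnergy n θ
    - cos θ * ((legendrePoly n).eval (cos θ)
        * (sin θ * (legendrePoly n).derivative.eval (cos θ)))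
    + (legendrePoly n).eval (cos θ) ^ 2 * (2 * sin θ)⁻¹

theorem hasDerivAt_legendreSoninEnergy (n : ℕ) {θ : ℝ} (hθ : sin θ ≠ 0) :
    HasDerivAt (legendreSoninEnergy n)
      (-(cos θ * (legendrePoly n).eval (cos θ) ^ 2 / (2 * sin θ ^ 2))) θ := by
  have hw := hasDerivAt_eval_cos (legendrePoly n) θ
  have hv := hasDerivAt_sin_mul_derivative_legendrePoly n θ
  refine ((((hasDerivAt_sin θ).mul (hasDerivAt_legendreEnergy n θ)).sub
    ((hasDerivAt_cos θ).mul (hw.mul hv))).add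
    ((hw.pow 2).mul (((hasDerivAt_sin θ).const_mul 2).inv (by positivity)))).congr_deriv ?_
  simp only [legendreEnergy, Pi.mul_apply, Pi.pow_apply, Pi.inv_apply]
  have hc : cos θ ^ 2 = 1 - sin θ ^ 2 := by rw [cos_sq']
  field_simp
  norm_num
  ring_nf
  simp only [hc]
  ring

theorem antitoneOn_legendreSoninEnergy (n : ℕ) :
    AntitoneOn (legendreSoninEnergy n) (Set.Ioc 0 (π / 2)) := by
  have hsin : ∀ t ∈ Set.Ioc 0 (π / 2), sin t ≠ 0 := fun t ht =>
    (sin_pos_of_pos_of_lt_pi ht.1 (by linarith [ht.2, pi_pos])).ne'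
  refine antitoneOn_of_hasDerivWithinAt_nonpos (convex_Ioc _ _)
    (fun t ht => (hasDerivAt_legendreSoninEnergy n (hsin t ht)).continuousAt.continuousWithinAt)
    (fun t ht => (hasDerivAt_legendreSoninEnergy n
      (hsin t (interior_subset ht))).hasDerivWithinAt) fun t ht => ?_
  have ht := interior_subset ht
  have hc : 0 ≤ cos t := cos_nonneg_of_mem_Icc ⟨by linarith [ht.1, pi_pos], ht.2⟩
  have : 0 ≤ cos t * (legendrePoly n).eval (cos t) ^ 2 / (2 * sin t ^ 2) := by positivity
  linarith

theorem legendrePoly_eval_cos_sq_le_one {n : ℕ} (hn : 1 ≤ n) {θ : ℝ}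
    (hθ : θ ∈ Set.Icc 0 (π / 2)) : (legendrePoly n).eval (cos θ) ^ 2 ≤ 1 := by
  have h := legendreEnergy_le n hθ
  have hn' : (1 : ℝ) ≤ n := by exact_mod_cast hn
  have hpos : (0 : ℝ) < n * (n + 1) := by positivity
  rw [legendreEnergy] at h
  refine le_of_mul_le_mul_left ?_ hpos
  linarith [sq_nonneg (sin θ * (legendrePoly n).derivative.eval (cos θ))]

theorem abs_cos_mul_legendrePoly_mul_derivative_le {n : ℕ} (hn : 1 ≤ n) {θ : ℝ}
    (hθ : θ ∈ Set.Icc 0 (π / 2)) :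
    |cos θ * ((legendrePoly n).eval (cos θ)
        * (sin θ * (legendrePoly n).derivative.eval (cos θ)))| ≤ n + 1 := by
  have h := legendreEnergy_le n hθ
  have hw := legendrePoly_eval_cos_sq_le_one hn hθ
  rw [legendreEnergy] at h
  set w := (legendrePoly n).eval (cos θ)
  set v := sin θ * (legendrePoly n).derivative.eval (cos θ)
  have hn0 : (0 : ℝ) ≤ n := by positivity
  have hv : |v| ≤ n + 1 := by
    refine abs_le_of_sq_le_sq ?_ (by positivity)
    nlinarith [mul_nonneg (mul_nonneg hn0 (by positivity : (0 : ℝ) ≤ n + 1)) (sq_nonneg w)]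
  have hw' : |w| ≤ 1 := by
    rw [← sq_le_one_iff_abs_le_one]; exact hw
  rw [abs_mul, abs_mul]
  calc |cos θ| * (|w| * |v|) ≤ 1 * (1 * (n + 1)) := by
        gcongr
        exact abs_cos_le_one θ
    _ = n + 1 := by ring

theorem legendreEnergy_mul_le {n : ℕ} (hn : 1 ≤ n) {θ : ℝ} (h1 : 1 / (n : ℝ) ≤ θ)
    (h2 : θ ≤ π / 2) : θ * legendreEnergy n θ ≤ 14 * n := by
  have hn' : (1 : ℝ) ≤ n := by exact_mod_cast hn
  set c : ℝ := 1 / (n : ℝ) with hc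
  have hc0 : 0 < c := by positivity
  have hθ0 : 0 < θ := hc0.trans_le h1
  have jordan : ∀ t, 0 ≤ t → t ≤ π / 2 → t ≤ 2 * sin t := fun t ht ht' => by
    have := mul_le_sin ht ht'
    rw [div_mul_eq_mul_div, div_le_iff₀ pi_pos] at this
    nlinarith [pi_le_four, sin_nonneg_of_nonneg_of_le_pi ht (by linarith [pi_pos])]
  have hmem : θ ∈ Set.Icc 0 (π / 2) := ⟨hθ0.le, h2⟩
  have hcmem : c ∈ Set.Icc 0 (π / 2) := ⟨hc0.le, h1.trans h2⟩
  have hanti := antitoneOn_legendreSoninEnergy n ⟨hc0, h1.trans h2⟩ ⟨hθ0, h2⟩ h1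
  have hsinθ : 0 < sin θ := sin_pos_of_pos_of_lt_pi hθ0 (by linarith [pi_pos])
  have hcn : c * n = 1 := by rw [hc]; field_simp
  have hlower : sin θ * legendreEnergy n θ - (n + 1) ≤ legendreSoninEnergy n θ := by
    have := (abs_le.1 (abs_cos_mul_legendrePoly_mul_derivative_le hn hmem)).2
    have : 0 ≤ (legendrePoly n).eval (cos θ) ^ 2 * (2 * sin θ)⁻¹ := by positivity
    rw [legendreSoninEnergy]
    linarith
  have hupper : legendreSoninEnergy n c ≤ 3 * n + 2 := by
    have ha := (abs_le.1 (abs_cos_mul_legendrePoly_mul_derivative_le hn hcmem)).1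
    have hb : (legendrePoly n).eval (cos c) ^ 2 * (2 * sin c)⁻¹ ≤ 1 * n := by
      gcongr
      · have := jordan c hc0.le hcmem.2
        exact inv_nonneg.2 (by linarith)
      · exact legendrePoly_eval_cos_sq_le_one hn hcmem
      · rw [inv_le_comm₀ (by linarith [jordan c hc0.le hcmem.2]) (by positivity), ← one_div]
        exact jordan c hc0.le hcmem.2
    have hs : sin c * legendreEnergy n c ≤ c * (n * (n + 1)) := by
      have h0 : 0 ≤ legendreEnergy n c := by rw [legendreEnergy]; positivity
      gcongr
      · exact (sin_lt hc0).le
      · exact legendreEnergy_le n hcmem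
    rw [← mul_assoc, hcn] at hs
    rw [legendreSoninEnergy]
    linarith
  have h0 : 0 ≤ legendreEnergy n θ := by rw [legendreEnergy]; positivity
  nlinarith [mul_le_mul_of_nonneg_right (jordan θ hθ0.le h2) h0]

theorem legendreEnergy_div_le {n : ℕ} (hn : 1 ≤ n) {θ : ℝ}
    (hθ : θ ∈ Set.Icc ((n : ℝ) ^ (-(3 : ℝ) / 4)) (π / 2)) :
    legendreEnergy n θ / (n * (n + 1)) ≤ 14 * (n : ℝ) ^ (-(1 : ℝ) / 4) := by
  have hn' : (1 : ℝ) ≤ n := by exact_mod_cast hn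
  have hn0 : (0 : ℝ) < n := by linarith
  have hc : 1 / (n : ℝ) ≤ (n : ℝ) ^ (-(3 : ℝ) / 4) := by
    rw [one_div, ← rpow_neg_one]
    exact rpow_le_rpow_of_exponent_le hn' (by norm_num)
  have h := legendreEnergy_mul_le hn (hc.trans hθ.1) hθ.2
  have h0 : 0 ≤ legendreEnergy n θ := by rw [legendreEnergy]; positivity
  set a := (n : ℝ) ^ (-(3 : ℝ) / 4)
  set b := (n : ℝ) ^ (-(1 : ℝ) / 4)
  have ha : 0 < a := rpow_pos_of_pos hn0 _
  have hb : 0 < b := rpow_pos_of_pos hn0 _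
  have hab : a * b * n = 1 := by
    rw [← rpow_add hn0]
    norm_num [rpow_neg_one]
    field_simp
  rw [div_le_iff₀ (by positivity)]
  refine le_of_mul_le_mul_left ?_ ha
  calc a * legendreEnergy n θ ≤ θ * legendreEnergy n θ := by gcongr; exact hθ.1
    _ ≤ 14 * n := h
    _ ≤ 14 * (a * b * n) * (n + 1) := by rw [hab]; linarith
    _ = a * (14 * b * (n * (n + 1))) := by ring

theorem exists_legendreRatio_near (ε : ℝ) (hε : 0 < ε) : ∃ N : ℕ, ∀ n : ℕ, N ≤ n →
    ∀ θ ∈ Set.Icc ((n : ℝ) ^ (-(3 : ℝ) / 4)) (π / 2),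
      |legendreRatio n θ - 1 / Real.sqrt 2| < ε := by
  have hcont : ContinuousAt
      (fun z : ℝ × ℝ => (1 - z.1) / Real.sqrt (2 - 2 * z.1 - z.2)) (0, 0) := by
    refine ContinuousAt.div (by fun_prop) (by fun_prop) ?_
    norm_num
  obtain ⟨δ, hδ, hball⟩ := Metric.continuousAt_iff.1 hcont ε hε
  have hlim : Tendsto (fun n : ℕ => 14 * (n : ℝ) ^ (-(1 : ℝ) / 4)) atTop (nhds 0) := by
    have := ((tendsto_rpow_neg_atTop (by norm_num : (0 : ℝ) < 1 / 4)).comp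
      tendsto_natCast_atTop_atTop).const_mul 14
    simpa [neg_div] using this
  have hη : 0 < min (δ ^ 2) (δ / 2) := by positivity
  obtain ⟨N, hN⟩ := eventually_atTop.1 ((hlim.eventually_lt_const hη).and (eventually_ge_atTop 1))
  refine ⟨N, fun n hn θ hθ => ?_⟩
  obtain ⟨hsmall, hn1⟩ := hN n hn
  have hE := (legendreEnergy_div_le hn1 hθ).trans_lt hsmall
  have hn' : (1 : ℝ) ≤ n := by exact_mod_cast hn1
  rw [legendreEnergy, add_div, mul_div_cancel_left₀ _ (by positivity)] at hE
  have hE1 := hE.trans_le (min_le_left _ _)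
  have hE2 := hE.trans_le (min_le_right _ _)
  set w := (legendrePoly n).eval (cos θ) with hw
  set q := (sin θ * (legendrePoly n).derivative.eval (cos θ)) ^ 2 / (n * (n + 1) : ℝ) with hq
  have hq0 : 0 ≤ q := by positivity
  have key := @hball (w, 2 * q) (by
    rw [Prod.dist_eq, max_lt_iff, Real.dist_0_eq_abs, Real.dist_0_eq_abs]
    constructor
    · exact abs_lt_of_sq_lt_sq (by linarith) hδ.le
    · rw [abs_of_nonneg (by positivity)]
      linarith [sq_nonneg w])
  rw [Real.dist_eq] at key
  have hratio : legendreRatio n θ = (1 - w) / Real.sqrt (2 - 2 * w - 2 * q) := by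
    rw [legendreRatio, deriv_legendre_s13, legendre_eq_eval]
    simp only [legendrePoly_derivative_eval_one]
    rw [hq, hw]
    congr 3
    field_simp
  rw [hratio]
  simpa using key

/-- As `n → ∞`, `sup_{θ ∈ [n^{−3/4}, π/2]} |ratio_n(θ) − 1/√2| → 0`; in particular the infimum
of the ratio over `θ ∈ [n^{−3/4}, π/2]` converges to `1/√2`. -/
theorem legendre_ratio_bulk_tendsto :
    (∀ ε : ℝ, 0 < ε → ∃ N : ℕ, ∀ n : ℕ, N ≤ n →
      ∀ θ ∈ Set.Icc ((n : ℝ) ^ (-(3 : ℝ) / 4)) (π / 2),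
        |legendreRatio n θ - 1 / Real.sqrt 2| < ε) ∧
    Tendsto (fun n : ℕ =>
        sInf (legendreRatio n '' Set.Icc ((n : ℝ) ^ (-(3 : ℝ) / 4)) (π / 2)))
      atTop (nhds (1 / Real.sqrt 2)) := by
  refine ⟨exists_legendreRatio_near, Metric.tendsto_atTop.2 fun ε hε => ?_⟩
  obtain ⟨N, hN⟩ := exists_legendreRatio_near (ε / 2) (half_pos hε)
  refine ⟨max N 1, fun n hn => ?_⟩
  have hclose := hN n (le_of_max_le_left hn)
  set S := Set.Icc ((n : ℝ) ^ (-(3 : ℝ) / 4)) (π / 2)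
  have hn1 : (1 : ℝ) ≤ n := by exact_mod_cast le_of_max_le_right hn
  have hmem : π / 2 ∈ S := by
    refine ⟨(rpow_le_one_of_one_le_of_nonpos hn1 (by norm_num)).trans ?_, le_rfl⟩
    linarith [pi_gt_three]
  have hlow : ∀ y ∈ legendreRatio n '' S, 1 / Real.sqrt 2 - ε / 2 ≤ y := by
    rintro _ ⟨θ, hθ, rfl⟩
    linarith [(abs_lt.1 (hclose θ hθ)).1]
  have h1 := le_csInf ⟨_, Set.mem_image_of_mem _ hmem⟩ hlow
  have h2 := csInf_le ⟨_, hlow⟩ (Set.mem_image_of_mem (legendreRatio n) hmem)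
  have h3 := (abs_lt.1 (hclose _ hmem)).2
  rw [Real.dist_eq, abs_lt]
  constructor <;> linarith
end
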